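/- In the multi-product IDP, fix a product i and a modification of product i's exogenous path, and let a_t = π_{θ,ω}(H_t, G) and ā_t = π_{θ,ω}(H̄_t^i, G) be the joint action sequences produced under the original and modified histories. If for every t the joint action deviation satisfies Σ_{j∈𝒜} |a_t^j − ā_t^j| ≤ c_a (the single-product robustness assumption), then the total cumulative discounted reward deviation over all products other than i is bounded by Σ_{j∈𝒜, j≠i} |Σ_{t=1}^T γ^t R_t^j − Σ_{t=1}^T γ^t R̄_t^j| ≤ T²·(p_max + c_max)·c_a, where R̄ denotes rewards along the modified trajectory; equivalently, the change in the per-product average cumulative reward (1/|𝒜|)·Σ_{j≠i} Σ_t γ^t R_t^j induced by modifying a single product's exogenous path is at most T²·(p_max + c_max)·c_a/|𝒜|. -/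

import Mathlib

/-!
STATEMENT 6: Multi-product IDP. Fix a product `i` and a modification of product
`i`'s exogenous path. Let `A t` and `Abar t` be the joint action sequences
produced by the combined policy under the original and modified histories (for
`j ≠ i` the exogenous data `D j, p j, c j, v j, I0 j` are identical under both
histories, so only the actions differ). If for every `t` the joint action
deviation satisfies `∑_j |A t j - Abar t j| ≤ ca` (single-product robustness),
then the total cumulative discounted reward deviation over all products `j ≠ i`
is at most `T²·(pmax + cmax)·ca`, and equivalently the change in the
per-product average cumulative reward is at most `T²·(pmax + cmax)·ca/|𝒜|`.
-/

open Finset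

namespace CapInv

/-- Arrivals at time `t`: the order `a k` placed at time `k < t` arrives iff its
lead time satisfies `v k = t - k`, i.e. `k + v k = t`. -/
def arrivals (a : ℕ → ℝ) (v : ℕ → ℕ) (t : ℕ) : ℝ :=
  ∑ k ∈ Finset.range t, if k + v k = t then a k else 0

/-- End-of-period inventory `I_t = max(I_{t-1} + J_t - D_t, 0)`. -/
def inv (I0 : ℝ) (D a : ℕ → ℝ) (v : ℕ → ℕ) : ℕ → ℝ
  | 0 => I0
  | t + 1 => max (inv I0 D a v t + arrivals a v (t + 1) - D (t + 1)) 0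

/-- Pre-demand inventory `I_{t_-} = I_{t-1} + J_t`. -/
def invPre (I0 : ℝ) (D a : ℕ → ℝ) (v : ℕ → ℕ) (t : ℕ) : ℝ :=
  inv I0 D a v (t - 1) + arrivals a v t

/-- Per-period reward `R_t = p_t·min(D_t, I_{t_-}) - c_t·a_t`. -/
def reward (I0 : ℝ) (D p c a : ℕ → ℝ) (v : ℕ → ℕ) (t : ℕ) : ℝ :=
  p t * min (D t) (invPre I0 D a v t) - c t * a t

lemma abs_arrivals_sub_le (a b : ℕ → ℝ) (v : ℕ → ℕ) (t : ℕ) :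
    |arrivals a v t - arrivals b v t| ≤
      ∑ k ∈ range t, if k + v k = t then |a k - b k| else 0 := by
  unfold arrivals
  rw [← sum_sub_distrib]
  refine (abs_sum_le_sum_abs _ _).trans (le_of_eq (sum_congr rfl fun k _ => ?_))
  split_ifs <;> simp

/-- Pre-demand inventories differ at most by the deviations of the orders delivered so far,
provided the same holds for the end-of-period inventories one step earlier. -/
lemma abs_inv_add_arrivals_sub_le (I0 : ℝ) (D a b : ℕ → ℝ) (v : ℕ → ℕ) (t : ℕ)
    (h : |inv I0 D a v t - inv I0 D b v t| ≤
      ∑ k ∈ range t, if k + v k ≤ t then |a k - b k| else 0) :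
    |(inv I0 D a v t + arrivals a v (t + 1)) - (inv I0 D b v t + arrivals b v (t + 1))| ≤
      ∑ k ∈ range (t + 1), if k + v k ≤ t + 1 then |a k - b k| else 0 := by
  have hJ := abs_arrivals_sub_le a b v (t + 1)
  have hmono : ∑ k ∈ range t, (if k + v k ≤ t then |a k - b k| else 0) ≤
      ∑ k ∈ range (t + 1), if k + v k ≤ t then |a k - b k| else 0 := by
    rw [sum_range_succ]
    have : (0 : ℝ) ≤ if t + v t ≤ t then |a t - b t| else 0 := by split_ifs <;> positivity
    linarith
  have hsplit : ∑ k ∈ range (t + 1), (if k + v k ≤ t + 1 then |a k - b k| else 0) =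
      ∑ k ∈ range (t + 1), (if k + v k ≤ t then |a k - b k| else 0) +
        ∑ k ∈ range (t + 1), if k + v k = t + 1 then |a k - b k| else 0 := by
    rw [← sum_add_distrib]
    refine sum_congr rfl fun k _ => ?_
    split_ifs <;> first | omega | simp
  rw [add_sub_add_comm]
  have := abs_add_le (inv I0 D a v t - inv I0 D b v t)
    (arrivals a v (t + 1) - arrivals b v (t + 1))
  linarith

lemma abs_inv_sub_le (I0 : ℝ) (D a b : ℕ → ℝ) (v : ℕ → ℕ) (t : ℕ) :
    |inv I0 D a v t - inv I0 D b v t| ≤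
      ∑ k ∈ range t, if k + v k ≤ t then |a k - b k| else 0 := by
  induction t with
  | zero => simp [inv]
  | succ t ih =>
    refine le_trans ?_ (abs_inv_add_arrivals_sub_le I0 D a b v t ih)
    rw [inv, inv]
    refine (abs_max_sub_max_le_abs _ _ _).trans (le_of_eq ?_)
    congr 1
    ring

lemma abs_invPre_sub_le (I0 : ℝ) (D a b : ℕ → ℝ) (v : ℕ → ℕ) (t : ℕ) :
    |invPre I0 D a v t - invPre I0 D b v t| ≤ ∑ k ∈ range t, |a k - b k| := by
  cases t with
  | zero => simp [invPre, inv, arrivals]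
  | succ t =>
    refine (abs_inv_add_arrivals_sub_le I0 D a b v t (abs_inv_sub_le I0 D a b v t)).trans
      (sum_le_sum fun k _ => ?_)
    split_ifs
    · exact le_rfl
    · exact abs_nonneg _

lemma abs_reward_sub_le (I0 : ℝ) (D p c a b : ℕ → ℝ) (v : ℕ → ℕ) (t : ℕ)
    {pmax cmax : ℝ} (hp : 0 ≤ p t) (hpmax : p t ≤ pmax) (hc : 0 ≤ c t) (hcmax : c t ≤ cmax) :
    |reward I0 D p c a v t - reward I0 D p c b v t| ≤
      pmax * ∑ k ∈ range t, |a k - b k| + cmax * |a t - b t| := by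
  have hmin : |min (D t) (invPre I0 D a v t) - min (D t) (invPre I0 D b v t)| ≤
      ∑ k ∈ range t, |a k - b k| := by
    refine le_trans ?_ (abs_invPre_sub_le I0 D a b v t)
    simpa using abs_min_sub_min_le_max (D t) (invPre I0 D a v t) (D t) (invPre I0 D b v t)
  have heq : reward I0 D p c a v t - reward I0 D p c b v t =
      p t * (min (D t) (invPre I0 D a v t) - min (D t) (invPre I0 D b v t)) -
        c t * (a t - b t) := by
    unfold reward
    ring
  rw [heq]
  refine (abs_sub _ _).trans ?_
  rw [abs_mul, abs_mul, abs_of_nonneg hp, abs_of_nonneg hc]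
  exact add_le_add (mul_le_mul hpmax hmin (abs_nonneg _) (hp.trans hpmax))
    (mul_le_mul_of_nonneg_right hcmax (abs_nonneg _))

theorem reward_deviation_under_single_product_modification
    {ι : Type*} [Fintype ι] [DecidableEq ι] (i : ι) (T : ℕ)
    (D p c : ι → ℕ → ℝ) (v : ι → ℕ → ℕ) (I0 : ι → ℝ)
    (A Abar : ℕ → ι → ℝ) (γ pmax cmax ca : ℝ)
    (hD : ∀ j t, 0 ≤ D j t)
    (hp : ∀ j t, 0 ≤ p j t) (hpmax : ∀ j t, p j t ≤ pmax)
    (hc : ∀ j t, 0 ≤ c j t) (hcmax : ∀ j t, c j t ≤ cmax)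
    (hI0 : ∀ j, 0 ≤ I0 j)
    (hA : ∀ t j, 0 ≤ A t j) (hAbar : ∀ t j, 0 ≤ Abar t j)
    (hγ0 : 0 ≤ γ) (hγ1 : γ ≤ 1)
    -- single-product robustness: the joint action deviation induced by
    -- modifying product i's exogenous path is at most `ca` in ℓ¹ at every time
    (hrobust : ∀ t, ∑ j : ι, |A t j - Abar t j| ≤ ca) :
    (∑ j ∈ univ.erase i,
        |(∑ t ∈ Icc 1 T, γ ^ t * reward (I0 j) (D j) (p j) (c j) (fun s => A s j) (v j) t) -
          ∑ t ∈ Icc 1 T, γ ^ t * reward (I0 j) (D j) (p j) (c j) (fun s => Abar s j) (v j) t|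
      ≤ (T : ℝ) ^ 2 * (pmax + cmax) * ca) ∧
    |((Fintype.card ι : ℝ)⁻¹ *
          ∑ j ∈ univ.erase i, ∑ t ∈ Icc 1 T,
            γ ^ t * reward (I0 j) (D j) (p j) (c j) (fun s => A s j) (v j) t) -
        (Fintype.card ι : ℝ)⁻¹ *
          ∑ j ∈ univ.erase i, ∑ t ∈ Icc 1 T,
            γ ^ t * reward (I0 j) (D j) (p j) (c j) (fun s => Abar s j) (v j) t|
      ≤ (T : ℝ) ^ 2 * (pmax + cmax) * ca / (Fintype.card ι : ℝ) := by
  have hpm : 0 ≤ pmax := (hp i 0).trans (hpmax i 0)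
  have hcm : 0 ≤ cmax := (hc i 0).trans (hcmax i 0)
  have hca : 0 ≤ ca := (sum_nonneg fun j _ => abs_nonneg _).trans (hrobust 0)
  have herase : ∀ t, ∑ j ∈ univ.erase i, |A t j - Abar t j| ≤ ca := fun t =>
    (sum_le_sum_of_subset_of_nonneg (erase_subset _ _) fun _ _ _ => abs_nonneg _).trans
      (hrobust t)
  have hmain : ∑ j ∈ univ.erase i,
        |(∑ t ∈ Icc 1 T, γ ^ t * reward (I0 j) (D j) (p j) (c j) (fun s => A s j) (v j) t) -
          ∑ t ∈ Icc 1 T, γ ^ t * reward (I0 j) (D j) (p j) (c j) (fun s => Abar s j) (v j) t|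
      ≤ (T : ℝ) ^ 2 * (pmax + cmax) * ca := by
    calc
      _ ≤ ∑ j ∈ univ.erase i, ∑ t ∈ Icc 1 T,
          (pmax * ∑ k ∈ range t, |A k j - Abar k j| + cmax * |A t j - Abar t j|) := by
        refine sum_le_sum fun j _ => ?_
        rw [← sum_sub_distrib]
        refine (abs_sum_le_sum_abs _ _).trans (sum_le_sum fun t _ => ?_)
        rw [← mul_sub, abs_mul, abs_of_nonneg (pow_nonneg hγ0 t)]
        exact (mul_le_of_le_one_left (abs_nonneg _) (pow_le_one₀ hγ0 hγ1)).trans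
          (abs_reward_sub_le (I0 j) (D j) (p j) (c j) (fun s => A s j) (fun s => Abar s j) (v j) t
            (hp j t) (hpmax j t) (hc j t) (hcmax j t))
      _ = ∑ t ∈ Icc 1 T, (pmax * ∑ k ∈ range t, ∑ j ∈ univ.erase i, |A k j - Abar k j| +
          cmax * ∑ j ∈ univ.erase i, |A t j - Abar t j|) := by
        rw [sum_comm]
        refine sum_congr rfl fun t _ => ?_
        rw [sum_add_distrib, ← mul_sum, ← mul_sum, sum_comm]
      _ ≤ ∑ t ∈ Icc 1 T, (T : ℝ) * (pmax + cmax) * ca := by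
        refine sum_le_sum fun t ht => ?_
        obtain ⟨ht1, htT⟩ := mem_Icc.mp ht
        have htT' : (t : ℝ) ≤ T := by exact_mod_cast htT
        have hT1 : (1 : ℝ) ≤ T := by exact_mod_cast ht1.trans htT
        have hpre : ∑ k ∈ range t, ∑ j ∈ univ.erase i, |A k j - Abar k j| ≤ T * ca := by
          refine (sum_le_sum fun k _ => herase k).trans ?_
          rw [sum_const, card_range, nsmul_eq_mul]
          exact mul_le_mul_of_nonneg_right htT' hca
        have hcur : ∑ j ∈ univ.erase i, |A t j - Abar t j| ≤ T * ca :=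
          (herase t).trans (le_mul_of_one_le_left hca hT1)
        have h1 := mul_le_mul_of_nonneg_left hpre hpm
        have h2 := mul_le_mul_of_nonneg_left hcur hcm
        linarith
      _ = (T : ℝ) ^ 2 * (pmax + cmax) * ca := by
        rw [sum_const, Nat.card_Icc, nsmul_eq_mul, Nat.add_sub_cancel]
        ring
  refine ⟨hmain, ?_⟩
  rw [← mul_sub, abs_mul, abs_of_nonneg (by positivity), ← sum_sub_distrib, div_eq_inv_mul]
  exact mul_le_mul_of_nonneg_left ((abs_sum_le_sum_abs _ _).trans hmain) (by positivity)

end CapInv
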